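/- Let ε_1, ε_2 ∈ {+1,-1}, τ_1, τ_2 ∈ R and nonzero ξ_1, ξ_2 ∈ R^2, and set τ_0 = τ_1 + τ_2, ξ_0 = ξ_1 + ξ_2. Then there is an absolute constant C such that ∠(ε_1 ξ_1, ε_2 ξ_2) ≤ C ( ( ⟨||τ_0| - |ξ_0||⟩ + ⟨|τ_1 + ε_1 |ξ_1||⟩ + ⟨|τ_2 + ε_2 |ξ_2||⟩ ) / min{⟨ξ_1⟩, ⟨ξ_2⟩} )^{1/2}. -/

import Mathlib

/-- If `a b (1 - cos θ) ≤ S (a + b)`, then `min a b * θ² ≤ π² S`. -/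
theorem mul_sq_le_of_mul_one_sub_cos_le {a b S θ : ℝ} (ha : 0 < a) (hb : 0 < b) (hS : 0 ≤ S)
    (hθ : |θ| ≤ Real.pi) (h : a * b * (1 - Real.cos θ) ≤ S * (a + b)) :
    min a b * θ ^ 2 ≤ Real.pi ^ 2 * S := by
  have hcos := Real.cos_le_one_sub_mul_cos_sq hθ
  have hmin : min a b * (1 - Real.cos θ) ≤ 2 * S := by
    rcases le_total a b with hab | hab
    · rw [min_eq_left hab]
      refine le_of_mul_le_mul_left ?_ hb
      nlinarith [mul_le_mul_of_nonneg_left hab hS]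
    · rw [min_eq_right hab]
      refine le_of_mul_le_mul_left ?_ ha
      nlinarith [mul_le_mul_of_nonneg_left hab hS]
  have hm : min a b * (2 / Real.pi ^ 2 * θ ^ 2) ≤ 2 * S :=
    (mul_le_mul_of_nonneg_left (by linarith) (lt_min ha hb).le).trans hmin
  have hpi : 0 < Real.pi ^ 2 := by positivity
  calc min a b * θ ^ 2 = Real.pi ^ 2 / 2 * (min a b * (2 / Real.pi ^ 2 * θ ^ 2)) := by
        field_simp
    _ ≤ Real.pi ^ 2 / 2 * (2 * S) := by gcongr
    _ = Real.pi ^ 2 * S := by ring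

/-- The modulus of `ε₁ ‖x‖ + ε₂ ‖y‖` differs from `‖x + y‖` by an amount controlling the angle
between `ε₁ x` and `ε₂ y`. -/
theorem norm_mul_norm_mul_one_sub_cos_angle_le {E : Type*} [NormedAddCommGroup E]
    [InnerProductSpace ℝ E] {ε₁ ε₂ : ℝ} (h₁ : ε₁ = 1 ∨ ε₁ = -1) (h₂ : ε₂ = 1 ∨ ε₂ = -1)
    (x y : E) :
    ‖x‖ * ‖y‖ * (1 - Real.cos (InnerProductGeometry.angle (ε₁ • x) (ε₂ • y))) ≤
      |(|ε₁ * ‖x‖ + ε₂ * ‖y‖| - ‖x + y‖)| * (‖x‖ + ‖y‖) := by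
  have hε₁ : ε₁ ^ 2 = 1 := by rcases h₁ with rfl | rfl <;> norm_num
  have hε₂ : ε₂ ^ 2 = 1 := by rcases h₂ with rfl | rfl <;> norm_num
  have hn₁ : ‖ε₁‖ = 1 := by rcases h₁ with rfl | rfl <;> norm_num
  have hn₂ : ‖ε₂‖ = 1 := by rcases h₂ with rfl | rfl <;> norm_num
  have hinner := InnerProductGeometry.cos_angle_mul_norm_mul_norm (ε₁ • x) (ε₂ • y)
  rw [norm_smul, norm_smul, hn₁, hn₂, one_mul, one_mul, real_inner_smul_left,
    real_inner_smul_right] at hinner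
  set c := Real.cos (InnerProductGeometry.angle (ε₁ • x) (ε₂ • y))
  have hadd := norm_add_sq_real x y
  have hsum : |ε₁ * ‖x‖ + ε₂ * ‖y‖| ≤ ‖x‖ + ‖y‖ := by
    refine (abs_add_le _ _).trans_eq ?_
    rw [abs_mul, abs_mul, ← Real.norm_eq_abs ε₁, ← Real.norm_eq_abs ε₂, hn₁, hn₂]
    simp
  have hdiff : (|ε₁ * ‖x‖ + ε₂ * ‖y‖| - ‖x + y‖) * (|ε₁ * ‖x‖ + ε₂ * ‖y‖| + ‖x + y‖) =
      ε₁ * ε₂ * (2 * (‖x‖ * ‖y‖ * (1 - c))) := by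
    have hsq := sq_abs (ε₁ * ‖x‖ + ε₂ * ‖y‖)
    have hxy : ε₁ * ε₂ * (c * (‖x‖ * ‖y‖)) = inner ℝ x y := by
      rw [hinner]
      linear_combination (ε₂ ^ 2 * hε₁ + hε₂) * inner ℝ x y
    linear_combination hsq - hadd + ‖x‖ ^ 2 * hε₁ + ‖y‖ ^ 2 * hε₂ + 2 * hxy
  have habs := congrArg abs hdiff
  rw [abs_mul, abs_mul, abs_mul, ← Real.norm_eq_abs ε₁, ← Real.norm_eq_abs ε₂, hn₁, hn₂,
    abs_of_nonneg (a := |ε₁ * ‖x‖ + ε₂ * ‖y‖| + ‖x + y‖) (by positivity)] at habs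
  have hle := le_abs_self (2 * (‖x‖ * ‖y‖ * (1 - c)))
  have hmul := mul_le_mul_of_nonneg_left (add_le_add hsum (norm_add_le x y))
    (abs_nonneg (|ε₁ * ‖x‖ + ε₂ * ‖y‖| - ‖x + y‖))
  linarith


/-- The standard angle estimate (Lemma 3.2 of Selberg–Tesfahun): near-resonant
wave interactions are nearly collinear. Here ⟨x⟩ = 1 + |x|. -/
theorem angle_estimate :
    ∃ C > (0 : ℝ), ∀ (ε₁ ε₂ : ℝ), (ε₁ = 1 ∨ ε₁ = -1) → (ε₂ = 1 ∨ ε₂ = -1) →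
      ∀ (τ₁ τ₂ : ℝ) (ξ₁ ξ₂ : EuclideanSpace ℝ (Fin 2)), ξ₁ ≠ 0 → ξ₂ ≠ 0 →
      InnerProductGeometry.angle (ε₁ • ξ₁) (ε₂ • ξ₂) ≤
        C * Real.sqrt
          (((1 + |(|τ₁ + τ₂| - ‖ξ₁ + ξ₂‖)|) + (1 + |τ₁ + ε₁ * ‖ξ₁‖|) +
              (1 + |τ₂ + ε₂ * ‖ξ₂‖|)) /
            min (1 + ‖ξ₁‖) (1 + ‖ξ₂‖)) := by
  refine ⟨Real.pi, Real.pi_pos, fun ε₁ ε₂ h₁ h₂ τ₁ τ₂ ξ₁ ξ₂ hξ₁ hξ₂ ↦ ?_⟩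
  have ha := norm_pos_iff.mpr hξ₁
  have hb := norm_pos_iff.mpr hξ₂
  set θ := InnerProductGeometry.angle (ε₁ • ξ₁) (ε₂ • ξ₂)
  have hθ₀ : 0 ≤ θ := InnerProductGeometry.angle_nonneg _ _
  have hθπ : θ ≤ Real.pi := InnerProductGeometry.angle_le_pi _ _
  set S := |(|τ₁ + τ₂| - ‖ξ₁ + ξ₂‖)| + |τ₁ + ε₁ * ‖ξ₁‖| + |τ₂ + ε₂ * ‖ξ₂‖| with hS
  have hS₀ : 0 ≤ S := by positivity
  have hdiff : |(|ε₁ * ‖ξ₁‖ + ε₂ * ‖ξ₂‖| - ‖ξ₁ + ξ₂‖)| ≤ S := by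
    have hτ : |(|ε₁ * ‖ξ₁‖ + ε₂ * ‖ξ₂‖| - |τ₁ + τ₂|)| ≤
        |τ₁ + ε₁ * ‖ξ₁‖| + |τ₂ + ε₂ * ‖ξ₂‖| := by
      rw [← abs_neg (τ₁ + τ₂)]
      refine (abs_abs_sub_abs_le _ _).trans ?_
      rw [show ε₁ * ‖ξ₁‖ + ε₂ * ‖ξ₂‖ - -(τ₁ + τ₂) =
        (τ₁ + ε₁ * ‖ξ₁‖) + (τ₂ + ε₂ * ‖ξ₂‖) by ring]
      exact abs_add_le _ _
    linarith [abs_sub_le |ε₁ * ‖ξ₁‖ + ε₂ * ‖ξ₂‖| |τ₁ + τ₂| ‖ξ₁ + ξ₂‖]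
  have hmain : min ‖ξ₁‖ ‖ξ₂‖ * θ ^ 2 ≤ Real.pi ^ 2 * S :=
    mul_sq_le_of_mul_one_sub_cos_le ha hb hS₀ (by rwa [abs_of_nonneg hθ₀])
      ((norm_mul_norm_mul_one_sub_cos_angle_le h₁ h₂ ξ₁ ξ₂).trans (by gcongr))
  have hθsq : θ ^ 2 ≤ Real.pi ^ 2 := by gcongr
  rw [min_add_add_left, ← div_le_iff₀' Real.pi_pos]
  apply Real.le_sqrt_of_sq_le
  have hmin := lt_min ha hb
  rw [div_pow, div_le_div_iff₀ (by positivity) (by positivity)]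
  nlinarith [sq_nonneg Real.pi]
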